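/- arXiv:2512.13366 — 3 statements merged into one kernel-verified Lean document; each statement's English description precedes it below -/
import Mathlib

section
/- Let Q be a real symmetric positive definite g×g matrix and let a be an extreme point of the Voronoi polytope V_Q. Let [a] denote the set of extreme points a' of V_Q with a ~ a'. Then [a] = {a − c : c ∈ 𝒟(a)}; consequently the convex hull of [a] equals {a − x : x ∈ convexHull(𝒟(a))}, and the cardinality of [a] equals the cardinality of 𝒟(a). -/
open Matrix

/-- The quadratic form `xᵀ Q x` associated to a `g × g` real matrix `Q`. -/
noncomputable def quadForm {g : ℕ} (Q : Matrix (Fin g) (Fin g) ℝ) (x : Fin g → ℝ) : ℝ :=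
  x ⬝ᵥ Q.mulVec x

/-- The real vector obtained from an integer vector by coordinatewise coercion. -/
def intVec {g : ℕ} (c : Fin g → ℤ) : Fin g → ℝ := fun i => (c i : ℝ)

/-- The Voronoi polytope `V_Q = {a : aᵀQa ≤ (a−c)ᵀQ(a−c) for all c ∈ ℤ^g}`. -/
def voronoiPolytope {g : ℕ} (Q : Matrix (Fin g) (Fin g) ℝ) : Set (Fin g → ℝ) :=
  {a | ∀ c : Fin g → ℤ, quadForm Q a ≤ quadForm Q (a - intVec c)}

/-- The Delaunay set `𝒟(a) = {c ∈ ℤ^g : aᵀQa = (a−c)ᵀQ(a−c)}`. -/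
def delaunaySet {g : ℕ} (Q : Matrix (Fin g) (Fin g) ℝ) (a : Fin g → ℝ) : Set (Fin g → ℤ) :=
  {c | quadForm Q a = quadForm Q (a - intVec c)}

/-- The Delaunay-translation equivalence class of a Voronoi vertex `a`: the set of extreme
points `a'` of `V_Q` with `a ~ a'`, i.e. `a' = a − c₀` for some `c₀ ∈ 𝒟(a)`. -/
def vertexClass {g : ℕ} (Q : Matrix (Fin g) (Fin g) ℝ) (a : Fin g → ℝ) : Set (Fin g → ℝ) :=
  {a' | a' ∈ Set.extremePoints ℝ (voronoiPolytope Q) ∧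
        ∃ c₀ ∈ delaunaySet Q a, a' = a - intVec c₀}

theorem quadForm_sub_affine {g : ℕ} (Q : Matrix (Fin g) (Fin g) ℝ) (x y e : Fin g → ℝ)
    (p q : ℝ) (hpq : p + q = 1) :
    quadForm Q (p • x + q • y - e) - quadForm Q (p • x + q • y) =
      p * (quadForm Q (x - e) - quadForm Q x) + q * (quadForm Q (y - e) - quadForm Q y) := by
  obtain rfl : q = 1 - p := by linarith
  simp only [quadForm, Matrix.mulVec_sub, Matrix.mulVec_add, Matrix.mulVec_smul,
    sub_dotProduct, dotProduct_sub, add_dotProduct, dotProduct_add, smul_dotProduct,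
    dotProduct_smul, smul_eq_mul]
  ring

theorem intVec_sub {g : ℕ} (c d : Fin g → ℤ) : intVec (c - d) = intVec c - intVec d := by
  ext i; simp [intVec]

theorem intVec_neg {g : ℕ} (c : Fin g → ℤ) : intVec (-c) = -intVec c := by
  ext i; simp [intVec]

theorem intVec_add {g : ℕ} (c d : Fin g → ℤ) : intVec (c + d) = intVec c + intVec d := by
  ext i; simp [intVec]

theorem intVec_inj {g : ℕ} : Function.Injective (intVec (g := g)) := by
  intro c d h
  ext i
  have := congrFun h i
  simpa [intVec] using this

theorem extreme_translate {g : ℕ} (Q : Matrix (Fin g) (Fin g) ℝ)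
    (a : Fin g → ℝ) (ha : a ∈ Set.extremePoints ℝ (voronoiPolytope Q))
    (c : Fin g → ℤ) (hc : c ∈ delaunaySet Q a) :
    a - intVec c ∈ Set.extremePoints ℝ (voronoiPolytope Q) := by
  have hc' : quadForm Q a = quadForm Q (a - intVec c) := hc
  rw [mem_extremePoints] at ha ⊢
  obtain ⟨haV, hext⟩ := ha
  refine ⟨?_, ?_⟩
  · intro d
    rw [← hc', sub_sub, ← intVec_add]
    exact haV _
  · rintro x hx y hy ⟨p, q, hp, hq, hpq, hxy⟩
    have key := quadForm_sub_affine Q x y (intVec (-c)) p q hpq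
    have h1 : a - intVec c - intVec (-c) = a := by rw [intVec_neg]; abel
    rw [hxy, h1, hc', sub_self] at key
    have hx0 := hx (-c)
    have hy0 := hy (-c)
    have ex : quadForm Q (x - intVec (-c)) = quadForm Q x := by
      nlinarith [mul_nonneg hq.le (sub_nonneg.2 hy0)]
    have ey : quadForm Q (y - intVec (-c)) = quadForm Q y := by
      nlinarith [mul_nonneg hp.le (sub_nonneg.2 hx0)]
    have mx : x + intVec c ∈ voronoiPolytope Q := by
      intro d
      have h2 := hx (d - c)
      have e1 : x - intVec (d - c) = x + intVec c - intVec d := by rw [intVec_sub]; abel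
      rw [intVec_neg, sub_neg_eq_add] at ex
      rw [ex, ← e1]; exact h2
    have my : y + intVec c ∈ voronoiPolytope Q := by
      intro d
      have h2 := hy (d - c)
      have e1 : y - intVec (d - c) = y + intVec c - intVec d := by rw [intVec_sub]; abel
      rw [intVec_neg, sub_neg_eq_add] at ey
      rw [ey, ← e1]; exact h2
    have hseg : a ∈ openSegment ℝ (x + intVec c) (y + intVec c) := by
      refine ⟨p, q, hp, hq, hpq, ?_⟩
      have : p • (x + intVec c) + q • (y + intVec c) =
          (p • x + q • y) + (p + q) • intVec c := by module
      rw [this, hxy, hpq, one_smul, sub_add_cancel]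
    obtain ⟨r1, r2⟩ := hext _ mx _ my hseg
    exact ⟨eq_sub_of_add_eq r1, eq_sub_of_add_eq r2⟩

/-- For a Voronoi vertex `a`, `[a] = {a − c : c ∈ 𝒟(a)}`; consequently
`conv [a] = a − conv 𝒟(a)` and `|[a]| = |𝒟(a)|`. -/
theorem stmt3 {g : ℕ} (Q : Matrix (Fin g) (Fin g) ℝ) (hQs : Q.IsSymm) (hQpd : Q.PosDef)
    (a : Fin g → ℝ) (ha : a ∈ Set.extremePoints ℝ (voronoiPolytope Q)) :
    vertexClass Q a = (fun c : Fin g → ℤ => a - intVec c) '' delaunaySet Q a ∧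
    convexHull ℝ (vertexClass Q a) =
      (fun x : Fin g → ℝ => a - x) '' convexHull ℝ (intVec '' delaunaySet Q a) ∧
    (vertexClass Q a).ncard = (delaunaySet Q a).ncard := by
  have h : vertexClass Q a = (fun c : Fin g → ℤ => a - intVec c) '' delaunaySet Q a := by
    ext z
    constructor
    · rintro ⟨_, c, hc, rfl⟩
      exact ⟨c, hc, rfl⟩
    · rintro ⟨c, hc, rfl⟩
      exact ⟨extreme_translate Q a ha c hc, c, hc, rfl⟩
  refine ⟨h, ?_, ?_⟩
  · let f : (Fin g → ℝ) →ᵃ[ℝ] (Fin g → ℝ) :=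
      AffineMap.const ℝ (Fin g → ℝ) a - AffineMap.id ℝ (Fin g → ℝ)
    have hf : (fun x : Fin g → ℝ => a - x) = f := by
      ext x; simp [f]
    rw [h, hf, AffineMap.image_convexHull, Set.image_image, ← hf]
  · rw [h]
    apply Set.ncard_image_of_injective
    intro c d hcd
    exact intVec_inj (sub_right_injective hcd)
end

section
/- Let Q be the tropical Riemann matrix of the genus-g banana graph. For every extreme point a of the Voronoi polytope V_Q and every i ∈ {1,…,n}, the coordinate (Bᵀa)_i is nonzero, and the map sending a to the sign vector σ(a) ∈ {−1,+1}^n with σ(a)_i = sign((Bᵀa)_i) is a bijection from the set of extreme points of V_Q onto the set of sign vectors in {−1,+1}^n taking both values +1 and −1 (which has cardinality 2^n − 2). These non-constant sign vectors correspond exactly to the strongly connected orientations of the banana graph. -/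
open Matrix

/-- The tropical Riemann matrix of the genus-`g` banana graph: diagonal entries `2`,
off-diagonal entries `1`. -/
noncomputable def bananaQ (g : ℕ) : Matrix (Fin g) (Fin g) ℝ :=
  Matrix.of fun i j => if i = j then 2 else 1

/-- The class `[k]` of Voronoi vertices: vectors with all coordinates in
`{−k/(g+1), (g+1−k)/(g+1)}` and either `k` or `k−1` coordinates equal to `(g+1−k)/(g+1)`. -/
def bananaClass (g k : ℕ) : Set (Fin g → ℝ) :=
  {a | (∀ i, a i = -(k : ℝ) / ((g : ℝ) + 1) ∨ a i = ((g : ℝ) + 1 - (k : ℝ)) / ((g : ℝ) + 1)) ∧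
       ({i | a i = ((g : ℝ) + 1 - (k : ℝ)) / ((g : ℝ) + 1)}.ncard = k ∨
        {i | a i = ((g : ℝ) + 1 - (k : ℝ)) / ((g : ℝ) + 1)}.ncard = k - 1)}

/-- The linear map `Bᵀ : ℝ^g → ℝ^{g+1}`, where `B` is the `g × (g+1)` matrix whose `i`-th row
is `e₁ − e_{i+1}`. -/
noncomputable def bananaBT (g : ℕ) (a : Fin g → ℝ) : Fin (g + 1) → ℝ :=
  fun j => ∑ i : Fin g,
    ((if (j : ℕ) = 0 then (1 : ℝ) else 0) - (if (j : ℕ) = (i : ℕ) + 1 then 1 else 0)) * a i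

lemma bt_zero (g : ℕ) (a : Fin g → ℝ) : bananaBT g a 0 = ∑ i, a i := by
  simp [bananaBT]

lemma bt_succ (g : ℕ) (a : Fin g → ℝ) (i : Fin g) : bananaBT g a i.succ = - a i := by
  simp only [bananaBT, Fin.val_succ]
  rw [Finset.sum_eq_single i]
  · simp
  · intro b _ hb
    have : (i : ℕ) ≠ b := fun h => hb (Fin.ext h.symm)
    simp [this]
  · simp

lemma bt_sum (g : ℕ) (a : Fin g → ℝ) : ∑ j, bananaBT g a j = 0 := by
  rw [Fin.sum_univ_succ]
  simp [bt_zero, bt_succ]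

lemma bt_inj (g : ℕ) {a b : Fin g → ℝ} (h : bananaBT g a = bananaBT g b) : a = b := by
  ext i
  have := congrFun h i.succ
  rw [bt_succ, bt_succ] at this
  linarith

lemma bt_inv (g : ℕ) (y : Fin (g+1) → ℝ) (h : ∑ j, y j = 0) :
    bananaBT g (fun i => - y i.succ) = y := by
  rw [Fin.sum_univ_succ] at h
  ext j
  refine Fin.cases ?_ (fun i => ?_) j
  · rw [bt_zero, Finset.sum_neg_distrib]; linarith
  · rw [bt_succ]; ring

lemma bt_comb (g : ℕ) (a b : Fin g → ℝ) (s t : ℝ) (j : Fin (g+1)) :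
    bananaBT g (s • a + t • b) j = s * bananaBT g a j + t * bananaBT g b j := by
  simp only [bananaBT, Finset.mul_sum, ← Finset.sum_add_distrib]
  apply Finset.sum_congr rfl
  intro i _
  simp only [Pi.add_apply, Pi.smul_apply, smul_eq_mul]
  ring

lemma bt_sub (g : ℕ) (a b : Fin g → ℝ) (j : Fin (g+1)) :
    bananaBT g (a - b) j = bananaBT g a j - bananaBT g b j := by
  have := bt_comb g a b 1 (-1) j
  rw [one_smul, neg_one_smul, ← sub_eq_add_neg] at this
  rw [this]; ring

lemma quad_eq (g : ℕ) (a : Fin g → ℝ) :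
    quadForm (bananaQ g) a = ∑ j, (bananaBT g a j)^2 := by
  rw [Fin.sum_univ_succ, bt_zero]
  simp only [bt_succ]
  have h : ∀ i, (bananaQ g).mulVec a i = a i + ∑ j, a j := by
    intro i
    simp only [Matrix.mulVec, dotProduct, bananaQ, Matrix.of_apply]
    have : ∀ j, (if i = j then (2:ℝ) else 1) * a j = (if i = j then a j else 0) + a j := by
      intro j; split_ifs <;> ring
    simp only [this, Finset.sum_add_distrib]
    simp
  simp only [quadForm, dotProduct, h, mul_add, Finset.sum_add_distrib, ← Finset.sum_mul]
  rw [add_comm, sq]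
  congr 1
  exact Finset.sum_congr rfl fun i _ => by ring

lemma exists_int (g : ℕ) (c : Fin g → ℤ) (j : Fin (g+1)) :
    ∃ z : ℤ, bananaBT g (intVec c) j = z := by
  refine Fin.cases ?_ (fun i => ?_) j
  · exact ⟨∑ i, c i, by rw [bt_zero]; simp [intVec]⟩
  · exact ⟨- c i, by rw [bt_succ]; simp [intVec]⟩

lemma mem_vor_iff (g : ℕ) (a : Fin g → ℝ) :
    a ∈ voronoiPolytope (bananaQ g) ↔ ∀ i j, bananaBT g a i - bananaBT g a j ≤ 1 := by
  constructor
  · intro h i j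
    by_cases hij : i = j
    · subst hij; simp
    let z : Fin (g+1) → ℤ := fun l => (if l = i then 1 else 0) - (if l = j then 1 else 0)
    have hz : ∑ l, ((z l : ℤ) : ℝ) = 0 := by simp [z]
    have h1 := h (fun l => - z l.succ)
    have h2 : bananaBT g (intVec (fun l => - z l.succ)) = fun l => (z l : ℝ) := by
      rw [← bt_inv g (fun l => (z l : ℝ)) hz]
      congr 1
      ext l; simp [intVec]
    rw [quad_eq, quad_eq] at h1
    simp only [bt_sub, h2] at h1
    have h3 : ∀ l, (bananaBT g a l - (z l : ℝ))^2 = (bananaBT g a l)^2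
        + ((if l = i then 1 - 2 * bananaBT g a l else 0)
          + (if l = j then 1 + 2 * bananaBT g a l else 0)) := by
      intro l
      simp only [z]
      by_cases h1 : l = i
      · have : l ≠ j := fun h => hij (h1 ▸ h)
        simp [h1, hij]; ring
      · by_cases h2 : l = j
        · have : j ≠ i := fun h => hij h.symm
          simp [h2, this]; ring
        · simp [h1, h2]
    simp only [h3, Finset.sum_add_distrib] at h1
    simp at h1
    linarith
  · intro h c
    rw [quad_eq, quad_eq]
    obtain ⟨i0, -, hi0⟩ := Finset.exists_min_image Finset.univ (bananaBT g a)
      ⟨0, Finset.mem_univ _⟩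
    set m := bananaBT g a i0
    have hs := bt_sum g (intVec c)
    have key : ∀ l, (bananaBT g a l)^2 ≤ (bananaBT g (a - intVec c) l)^2
        + (2 * m + 1) * bananaBT g (intVec c) l := by
      intro l
      rw [bt_sub]
      obtain ⟨z, hz⟩ := exists_int g c l
      rw [hz]
      have l1 := hi0 l (Finset.mem_univ _)
      have l2 := h l i0
      set y := bananaBT g a l
      have l2' : y - m ≤ 1 := l2
      rcases lt_trichotomy z 0 with h0 | h0 | h0
      · have : (z : ℝ) ≤ -1 := by exact_mod_cast Int.le_sub_one_of_lt h0
        nlinarith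
      · subst h0; simp
      · have : (1 : ℝ) ≤ z := by exact_mod_cast h0
        nlinarith
    calc _ ≤ _ := Finset.sum_le_sum fun l _ => key l
      _ = _ := by rw [Finset.sum_add_distrib, ← Finset.mul_sum, hs]; ring

lemma perturb (g : ℕ) (a : Fin g → ℝ)
    (ha : a ∈ Set.extremePoints ℝ (voronoiPolytope (bananaQ g))) (hg : 1 ≤ g) (m : ℝ)
    (hm : ∀ j, m ≤ bananaBT g a j ∧ bananaBT g a j ≤ m + 1) (i : Fin (g+1)) :
    bananaBT g a i = m ∨ bananaBT g a i = m + 1 := by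
  by_contra hcon
  push Not at hcon
  have h1 : m < bananaBT g a i := lt_of_le_of_ne (hm i).1 (Ne.symm hcon.1)
  have h2 : bananaBT g a i < m + 1 := lt_of_le_of_ne (hm i).2 hcon.2
  obtain ⟨ε, he, he1, he2⟩ : ∃ ε : ℝ, 0 < ε ∧ ε ≤ bananaBT g a i - m ∧
      ε ≤ m + 1 - bananaBT g a i :=
    ⟨min (bananaBT g a i - m) (m + 1 - bananaBT g a i),
      lt_min (by linarith) (by linarith), min_le_left _ _, min_le_right _ _⟩
  have hn : (g : ℝ) + 1 ≠ 0 := by positivity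
  let w : Fin (g+1) → ℝ := fun l => (if l = i then 1 else 0) - 1 / ((g:ℝ)+1)
  have hw : ∑ l, w l = 0 := by
    simp [w]; field_simp; simp
  let d : Fin g → ℝ := fun l => - w l.succ
  have hd : bananaBT g d = w := bt_inv g w hw
  have hmem : ∀ t : ℝ, |t| ≤ ε → (1:ℝ) • a + t • d ∈ voronoiPolytope (bananaQ g) := by
    intro t ht
    rw [abs_le] at ht
    rw [mem_vor_iff]
    intro p q
    rw [bt_comb, bt_comb, hd]
    have hp := hm p
    have hq := hm q
    simp only [w]
    by_cases hpi : p = i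
    · by_cases hqi : q = i
      · simp [hpi, hqi]
      · simp only [hpi, hqi, if_true, if_false]; nlinarith
    · by_cases hqi : q = i
      · simp only [hpi, hqi, if_true, if_false]; nlinarith
      · simp only [hpi, hqi, if_false]; nlinarith
  have hx := ha.2 (hmem ε (by rw [abs_of_pos he])) (hmem (-ε) (by rw [abs_neg, abs_of_pos he]))
    ⟨1/2, 1/2, by norm_num, by norm_num, by norm_num, by
      ext l; simp only [Pi.add_apply, Pi.smul_apply, smul_eq_mul]; ring⟩
  have h3 := congrArg (fun b => bananaBT g b i) hx
  simp only [bt_comb, hd] at h3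
  have h4 : w i = 0 := by
    have : ε * w i = 0 := by linarith
    rcases mul_eq_zero.1 this with h | h
    · linarith
    · exact h
  simp only [w, if_true] at h4
  have hg' : (1:ℝ) ≤ g := by exact_mod_cast hg
  field_simp at h4
  linarith

lemma ext_struct (g : ℕ) (a : Fin g → ℝ)
    (ha : a ∈ Set.extremePoints ℝ (voronoiPolytope (bananaQ g))) (hg : 1 ≤ g) :
    ∃ m : ℝ, -1 < m ∧ m < 0 ∧ (∀ i, bananaBT g a i = m ∨ bananaBT g a i = m + 1) ∧
      (∃ i, bananaBT g a i = m) ∧ (∃ i, bananaBT g a i = m + 1) := by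
  have hV := (mem_vor_iff g a).1 ha.1
  obtain ⟨i0, -, hi0⟩ := Finset.exists_min_image Finset.univ (bananaBT g a)
      ⟨0, Finset.mem_univ _⟩
  have hs := bt_sum g a
  have hall := perturb g a ha hg (bananaBT g a i0)
    (fun j => ⟨hi0 j (Finset.mem_univ _), by linarith [hV j i0]⟩)
  set m := bananaBT g a i0 with hmdef
  have hex : ∃ i, bananaBT g a i = m + 1 := by
    by_contra hcon
    push Not at hcon
    have hc : ∀ i, bananaBT g a i = m := fun i => (hall i).resolve_right (hcon i)
    have hm0 : m = 0 := by
      simp only [hc] at hs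
      simp at hs
      rcases hs with h | h
      · exfalso
        have : (0:ℝ) < (g:ℝ) + 1 := by positivity
        linarith
      · exact h
    have := perturb g a ha hg (-1/2) (fun j => by rw [hc, hm0]; norm_num) 0
    rw [hc, hm0] at this
    norm_num at this
  obtain ⟨i1, hi1⟩ := hex
  refine ⟨m, ?_, ?_, hall, ⟨i0, rfl⟩, ⟨i1, hi1⟩⟩
  · by_contra hcon
    push Not at hcon
    have : ∑ j, bananaBT g a j < ∑ j : Fin (g+1), (0:ℝ) :=
      Finset.sum_lt_sum (fun j _ => by rcases hall j with h | h <;> linarith)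
        ⟨i0, Finset.mem_univ _, by linarith⟩
    simp [hs] at this
  · by_contra hcon
    push Not at hcon
    have : ∑ j : Fin (g+1), (0:ℝ) < ∑ j, bananaBT g a j :=
      Finset.sum_lt_sum (fun j _ => by rcases hall j with h | h <;> linarith)
        ⟨i1, Finset.mem_univ _, by linarith⟩
    simp [hs] at this

lemma two_val (g : ℕ) (p : Fin (g+1) → ℝ) (m : ℝ) (y : Fin (g+1) → ℝ)
    (h : ∀ i, y i = m + p i) (hs : ∑ i, y i = 0) :
    m = - (∑ i, p i) / ((g:ℝ)+1) := by
  simp only [h, Finset.sum_add_distrib] at hs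
  simp at hs
  have hn : (g : ℝ) + 1 ≠ 0 := by positivity
  field_simp
  linarith

lemma ext_of_two_val (g : ℕ) (a : Fin g → ℝ) (m : ℝ)
    (hall : ∀ i, bananaBT g a i = m ∨ bananaBT g a i = m + 1)
    (h0 : ∃ i, bananaBT g a i = m) (h1 : ∃ i, bananaBT g a i = m + 1) :
    a ∈ Set.extremePoints ℝ (voronoiPolytope (bananaQ g)) := by
  refine ⟨(mem_vor_iff g a).2 fun i j => by
    rcases hall i with h | h <;> rcases hall j with h' | h' <;> linarith, ?_⟩
  intro u hu v hv ⟨s, t, hs, ht, hst, huv⟩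
  rw [mem_vor_iff] at hu hv
  have hy : ∀ j, bananaBT g a j = s * bananaBT g u j + t * bananaBT g v j := by
    intro j; rw [← huv, bt_comb]
  obtain ⟨i0, hi0⟩ := h0
  obtain ⟨i1, hi1⟩ := h1
  have key : ∀ i j, bananaBT g a i = m + 1 → bananaBT g a j = m →
      bananaBT g u i = bananaBT g u j + 1 := by
    intro i j hi hj
    have e1 := hu i j
    have e2 := hv i j
    rw [hy] at hi hj
    have e3 : s * (bananaBT g u i - bananaBT g u j) + t * (bananaBT g v i - bananaBT g v j) = 1 := by
      linarith
    have e4 := mul_le_mul_of_nonneg_left e2 ht.le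
    have e5 : s * 1 ≤ s * (bananaBT g u i - bananaBT g u j) := by linarith
    have := le_of_mul_le_mul_left e5 hs
    linarith
  have hd : ∀ j, bananaBT g u j = (bananaBT g u i0 - m) + bananaBT g a j := by
    intro j
    rcases hall j with h | h
    · have := key i1 j hi1 h
      have := key i1 i0 hi1 hi0
      linarith
    · have := key j i0 h hi0
      linarith
  have := two_val g _ _ _ hd (bt_sum g u)
  rw [bt_sum] at this
  apply bt_inj
  ext j
  rw [hd, this]; simp

/-- Every extreme point `a` of the Voronoi polytope of the banana graph has all coordinates
of `Bᵀa` nonzero, and `a ↦ σ(a)`, `σ(a)_i = sign((Bᵀa)_i)`, is a bijection from the set of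
extreme points onto the set of non-constant sign vectors in `{−1,+1}^{g+1}` (the strongly
connected orientations of the banana graph), a set of cardinality `2^{g+1} − 2`. -/
theorem stmt9 (g : ℕ) (hg : 1 ≤ g) :
    (∀ a ∈ Set.extremePoints ℝ (voronoiPolytope (bananaQ g)), ∀ i, bananaBT g a i ≠ 0) ∧
    Set.BijOn (fun (a : Fin g → ℝ) (i : Fin (g + 1)) =>
        if 0 < bananaBT g a i then (1 : ℤ) else -1)
      (Set.extremePoints ℝ (voronoiPolytope (bananaQ g)))
      {s : Fin (g + 1) → ℤ | (∀ i, s i = 1 ∨ s i = -1) ∧ (∃ i, s i = 1) ∧ ∃ i, s i = -1} ∧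
    {s : Fin (g + 1) → ℤ |
        (∀ i, s i = 1 ∨ s i = -1) ∧ (∃ i, s i = 1) ∧ ∃ i, s i = -1}.ncard =
      2 ^ (g + 1) - 2 := by
  refine ⟨?_, ⟨?_, ?_, ?_⟩, ?_⟩
  · intro a ha i
    obtain ⟨m, h1, h2, hall, -, -⟩ := ext_struct g a ha hg
    rcases hall i with h | h <;> rw [h] <;> linarith
  · intro a ha
    obtain ⟨m, h1, h2, hall, ⟨i0, hi0⟩, ⟨i1, hi1⟩⟩ := ext_struct g a ha hg
    refine ⟨fun i => ?_, ⟨i1, ?_⟩, ⟨i0, ?_⟩⟩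
    · dsimp only; split_ifs <;> simp
    · exact if_pos (by linarith)
    · exact if_neg (by linarith)
  · intro a ha b hb hab
    obtain ⟨m, h1, h2, hall, -, -⟩ := ext_struct g a ha hg
    obtain ⟨m', h1', h2', hall', -, -⟩ := ext_struct g b hb hg
    have hiff : ∀ i, 0 < bananaBT g a i ↔ 0 < bananaBT g b i := by
      intro i
      have := congrFun hab i
      dsimp only at this
      split_ifs at this with e1 e2 e2 <;> first | (exact iff_of_true e1 e2) | (exact iff_of_false e1 e2) | (norm_num at this)
    have hb' : ∀ i, bananaBT g b i = (m' - m) + bananaBT g a i := by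
      intro i
      have := hiff i
      rcases hall i with h | h <;> rcases hall' i with h' | h'
      · linarith
      · have := this.2 (by linarith); linarith
      · have := this.1 (by linarith); linarith
      · linarith
    have := two_val g _ _ _ hb' (bt_sum g b)
    rw [bt_sum] at this
    apply bt_inj
    ext j
    rw [hb', this]; simp
  · rintro s ⟨hs, ⟨i1, hi1⟩, ⟨i0, hi0⟩⟩
    let p : Fin (g+1) → ℝ := fun i => if s i = 1 then 1 else 0
    let m : ℝ := - (∑ i, p i) / ((g:ℝ)+1)
    have hn : (g : ℝ) + 1 ≠ 0 := by positivity
    have hsum : ∑ i, (m + p i) = 0 := by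
      rw [Finset.sum_add_distrib]
      simp [m]
      field_simp
      ring
    have hy := bt_inv g (fun i => m + p i) hsum
    have hext : (fun i : Fin g => - (m + p i.succ)) ∈
        Set.extremePoints ℝ (voronoiPolytope (bananaQ g)) := by
      apply ext_of_two_val g _ m
      · intro i
        rw [hy]
        rcases hs i with h | h <;> simp [p, h]
      · exact ⟨i0, by rw [hy]; simp [p, hi0]⟩
      · exact ⟨i1, by rw [hy]; simp [p, hi1]⟩
    refine ⟨_, hext, ?_⟩
    have hp : ∀ i, 0 ≤ p i ∧ p i ≤ 1 := fun i => by
      simp only [p]; split_ifs <;> norm_num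
    have hpos : 0 < (g:ℝ) + 1 := by positivity
    have hm0 : m < 0 := by
      have : ∑ j : Fin (g+1), (0:ℝ) < ∑ j, p j :=
        Finset.sum_lt_sum (fun j _ => (hp j).1) ⟨i1, Finset.mem_univ _, by simp [p, hi1]⟩
      simp only [Finset.sum_const_zero] at this
      exact div_neg_of_neg_of_pos (by linarith) hpos
    have hm1 : -1 < m := by
      have : ∑ j, p j < ∑ j : Fin (g+1), (1:ℝ) :=
        Finset.sum_lt_sum (fun j _ => (hp j).2) ⟨i0, Finset.mem_univ _, by simp [p, hi0]⟩
      simp at this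
      rw [lt_div_iff₀ hpos]
      linarith
    ext i
    simp only [hy]
    rcases hs i with h | h
    · rw [h]; exact if_pos (by simp [p, h]; linarith)
    · rw [h]; exact if_neg (by simp [p, h]; linarith)
  · have : {s : Fin (g + 1) → ℤ |
        (∀ i, s i = 1 ∨ s i = -1) ∧ (∃ i, s i = 1) ∧ ∃ i, s i = -1} =
        ↑((Fintype.piFinset (fun _ : Fin (g+1) => ({1, -1} : Finset ℤ))) \
          {(fun _ => 1), (fun _ => -1)}) := by
      ext s
      simp only [Set.mem_setOf_eq, Finset.coe_sdiff, Set.mem_diff, Finset.mem_coe,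
        Fintype.mem_piFinset, Finset.mem_insert, Finset.mem_singleton]
      refine and_congr_right fun hs => ?_
      constructor
      · rintro ⟨⟨i, hi⟩, ⟨j, hj⟩⟩ (h | h)
        · rw [h] at hj; norm_num at hj
        · rw [h] at hi; norm_num at hi
      · intro h
        push Not at h
        constructor
        · by_contra hc
          push Not at hc
          exact h.2 (funext fun i => (hs i).resolve_left (hc i))
        · by_contra hc
          push Not at hc
          exact h.1 (funext fun i => (hs i).resolve_right (hc i))
    have hne : (fun _ : Fin (g+1) => (1:ℤ)) ≠ (fun _ => -1) := by
      intro h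
      have := congrFun h 0
      norm_num at this
    rw [this, Set.ncard_coe_finset, Finset.card_sdiff_of_subset, Fintype.card_piFinset,
      Finset.card_pair hne]
    · simp
    · intro s hs
      simp only [Finset.mem_insert, Finset.mem_singleton] at hs
      rcases hs with rfl | rfl <;> simp
end

section
/- Let g ≥ 1, n = g+1, k ∈ {1,…,g}, let κ₁,…,κ_n ∈ ℂ be pairwise distinct and β₀ = 1, β₁,…,β_g ∈ ℂ nonzero. Let A, the minors A_J, the Vandermonde minors K_J, and the coefficients α_J be as in the banana Hirota parametrization, with I_k = {1,…,k}. For J a k-subset of {1,…,n} define c_J ∈ ℤ^g by (c_J)_l = [l+1 ∈ I_k] − [l+1 ∈ J] (Iverson brackets), and set U_l = κ₁ − κ_{l+1}, V_l = κ₁² − κ_{l+1}², W_l = κ₁³ − κ_{l+1}³. For (x,y,t) ∈ ℂ³ let E_j(x,y,t) = exp(κ_j x + κ_j² y + κ_j³ t). Then for all (x,y,t): Σ_J α_J · exp( Σ_{l=1}^{g} (c_J)_l (U_l x + V_l y + W_l t) ) = (1 / (K_{I_k} · ∏_{i ∈ I_k} E_i(x,y,t))) · Σ_J A_J K_J ∏_{j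 ∈ J} E_j(x,y,t), both sums over all k-element subsets J of {1,…,n}. In other words, the tropical tau function equals the Grassmannian multi-soliton tau function τ_A divided by K_{I_k} E_{I_k}. -/
open Finset

/-- The index set `I_k = {1,…,k}` (0-indexed: the first `k` elements of `Fin n`). -/
def IkSet (k n : ℕ) : Finset (Fin n) := Finset.univ.filter (fun j => (j : ℕ) < k)

/-- The `k × n` matrix `A` of the banana Hirota parametrization (0-indexed): `A_{ij} = δ_{ij}`
on the first `k` columns, and
`A_{ij} = β_{i−1}/(β_{j−1}(κ_j − κ_i)²) · ∏_{l ∈ I_k, l ≠ i}(κ_i − κ_l)/(κ_j − κ_l)`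
on the remaining columns. -/
noncomputable def bananaA {𝔽 : Type*} [Field 𝔽] (g k : ℕ) (hk : k ≤ g)
    (κ β : Fin (g + 1) → 𝔽) : Matrix (Fin k) (Fin (g + 1)) 𝔽 :=
  Matrix.of fun i j =>
    if (j : ℕ) < k then (if (i : ℕ) = (j : ℕ) then 1 else 0)
    else
      (β (Fin.castLE (Nat.le_succ_of_le hk) i) /
          (β j * (κ j - κ (Fin.castLE (Nat.le_succ_of_le hk) i)) ^ 2)) *
        ∏ l ∈ (IkSet k (g + 1)).erase (Fin.castLE (Nat.le_succ_of_le hk) i),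
          (κ (Fin.castLE (Nat.le_succ_of_le hk) i) - κ l) / (κ j - κ l)

/-- The maximal minor of a `k × n` matrix on the columns of a `k`-element subset `J`, taken in
increasing order. -/
noncomputable def maximalMinor {𝔽 : Type*} [Field 𝔽] {k n : ℕ} (A : Matrix (Fin k) (Fin n) 𝔽)
    (J : Finset (Fin n)) (hJ : J.card = k) : 𝔽 :=
  Matrix.det (Matrix.of fun i i' : Fin k => A i (J.orderIsoOfFin hJ i').val)

/-- The Vandermonde minor `K_J = ∏_{j < j′, j,j′ ∈ J}(κ_{j′} − κ_j)`. -/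
noncomputable def vandK {𝔽 : Type*} [Field 𝔽] {n : ℕ} (κ : Fin n → 𝔽) (J : Finset (Fin n)) :
    𝔽 :=
  ∏ p ∈ (J ×ˢ J).filter (fun p => p.1 < p.2), (κ p.2 - κ p.1)

/-- The coefficient `α_J`: writing `I_k∖J = {i₁ < … < i_s}` and `J∖I_k = {j₁ < … < j_s}`,
`α_J = [∏_{l<m}(κ_{i_m}−κ_{i_l})²(κ_{j_m}−κ_{j_l})² / ∏_{l,m}(κ_{j_m}−κ_{i_l})²]
· (∏_{i∈I_k∖J} β_{i−1})/(∏_{j∈J∖I_k} β_{j−1})` (empty products equal to `1`). -/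
noncomputable def alphaJ {𝔽 : Type*} [Field 𝔽] {n : ℕ} (k : ℕ) (κ β : Fin n → 𝔽)
    (J : Finset (Fin n)) : 𝔽 :=
  (((∏ p ∈ ((IkSet k n \ J) ×ˢ (IkSet k n \ J)).filter (fun p => p.1 < p.2),
        (κ p.2 - κ p.1) ^ 2) *
      ∏ p ∈ ((J \ IkSet k n) ×ˢ (J \ IkSet k n)).filter (fun p => p.1 < p.2),
        (κ p.2 - κ p.1) ^ 2) /
    ∏ p ∈ (IkSet k n \ J) ×ˢ (J \ IkSet k n), (κ p.2 - κ p.1) ^ 2) *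
  ((∏ i ∈ IkSet k n \ J, β i) / ∏ j ∈ J \ IkSet k n, β j)

noncomputable def hh {n : ℕ} (κ : Fin n → ℂ) (a b : Fin n) : ℂ :=
  if a < b then κ b - κ a else if b < a then κ a - κ b else 1

lemma hh_symm {n : ℕ} (κ : Fin n → ℂ) (a b : Fin n) : hh κ a b = hh κ b a := by
  unfold hh
  rcases lt_trichotomy a b with h | h | h
  · simp [h, h.not_gt]
  · simp [h]
  · simp [h, h.not_gt]

lemma hh_ne {n : ℕ} (κ : Fin n → ℂ) (hκ : Function.Injective κ) (a b : Fin n) :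
    hh κ a b ≠ 0 := by
  unfold hh
  split_ifs with h h
  · exact sub_ne_zero.2 (fun e => h.ne' (hκ e))
  · exact sub_ne_zero.2 (fun e => h.ne' (hκ e))
  · exact one_ne_zero

lemma hh_sq {n : ℕ} (κ : Fin n → ℂ) (a b : Fin n) (hab : a ≠ b) :
    hh κ a b ^ 2 = (κ a - κ b) ^ 2 := by
  unfold hh
  rcases lt_or_gt_of_ne hab with h | h
  · simp only [h, if_true]; ring
  · simp [h, h.not_gt]

noncomputable def SS {n : ℕ} (κ : Fin n → ℂ) (X Y : Finset (Fin n)) : ℂ :=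
  ∏ a ∈ X, ∏ b ∈ Y, hh κ a b

lemma SS_symm {n : ℕ} (κ : Fin n → ℂ) (X Y : Finset (Fin n)) : SS κ X Y = SS κ Y X := by
  unfold SS
  rw [Finset.prod_comm]
  refine Finset.prod_congr rfl fun a _ => Finset.prod_congr rfl fun b _ => hh_symm κ _ _

lemma SS_ne {n : ℕ} (κ : Fin n → ℂ) (hκ : Function.Injective κ) (X Y : Finset (Fin n)) :
    SS κ X Y ≠ 0 :=
  Finset.prod_ne_zero_iff.2 fun _ _ => Finset.prod_ne_zero_iff.2 fun _ _ => hh_ne κ hκ _ _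

lemma vandK_sq {n : ℕ} (κ : Fin n → ℂ) (J : Finset (Fin n)) : vandK κ J ^ 2 = SS κ J J := by
  have h1 : vandK κ J = ∏ a ∈ J, ∏ b ∈ J, if a < b then κ b - κ a else 1 := by
    unfold vandK
    rw [Finset.prod_filter, Finset.prod_product]
  have h2 : vandK κ J = ∏ a ∈ J, ∏ b ∈ J, if b < a then κ a - κ b else 1 := by
    rw [h1, Finset.prod_comm]
  rw [sq]
  nth_rewrite 1 [h1]
  rw [h2, SS, ← Finset.prod_mul_distrib]
  refine Finset.prod_congr rfl fun a _ => ?_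
  rw [← Finset.prod_mul_distrib]
  refine Finset.prod_congr rfl fun b _ => ?_
  unfold hh
  rcases lt_trichotomy a b with h | h | h
  · simp [h, h.not_gt]
  · simp [h]
  · simp [h, h.not_gt]

lemma vandK_ne {n : ℕ} (κ : Fin n → ℂ) (hκ : Function.Injective κ) (J : Finset (Fin n)) :
    vandK κ J ≠ 0 := by
  intro h
  have := vandK_sq κ J
  rw [h] at this
  exact SS_ne κ hκ J J (by rw [← this]; simp)

lemma alphaJ_eq {n : ℕ} (k : ℕ) (κ β : Fin n → ℂ) (J : Finset (Fin n)) :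
    alphaJ k κ β J = SS κ (IkSet k n \ J) (IkSet k n \ J) * SS κ (J \ IkSet k n) (J \ IkSet k n) /
      SS κ (IkSet k n \ J) (J \ IkSet k n) ^ 2 *
      ((∏ i ∈ IkSet k n \ J, β i) / ∏ j ∈ J \ IkSet k n, β j) := by
  unfold alphaJ
  rw [← vandK_sq, ← vandK_sq]
  congr 2
  · unfold vandK
    rw [Finset.prod_pow, Finset.prod_pow]
  · unfold SS
    rw [Finset.prod_product, ← Finset.prod_pow]
    refine Finset.prod_congr rfl fun a ha => ?_
    rw [← Finset.prod_pow]
    refine Finset.prod_congr rfl fun b hb => ?_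
    rw [hh_symm, hh_sq]
    rintro rfl
    simp at ha hb
    exact ha.2 hb.1

lemma SS_inter_left {n : ℕ} (κ : Fin n → ℂ) (X Z Y : Finset (Fin n)) :
    SS κ X Y = SS κ (X ∩ Z) Y * SS κ (X \ Z) Y := by
  unfold SS
  rw [Finset.prod_inter_mul_prod_sdiff]

lemma SS_inter_right {n : ℕ} (κ : Fin n → ℂ) (X Z Y : Finset (Fin n)) :
    SS κ Y X = SS κ Y (X ∩ Z) * SS κ Y (X \ Z) := by
  rw [SS_symm, SS_inter_left κ X Z, SS_symm κ Y, SS_symm κ Y]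

lemma alphaJ_eq2 {n : ℕ} (k : ℕ) (κ β : Fin n → ℂ) (hκ : Function.Injective κ)
    (hβ : ∀ j, β j ≠ 0) (J : Finset (Fin n)) :
    alphaJ k κ β J = SS κ (IkSet k n) (IkSet k n) * SS κ J J / SS κ J (IkSet k n) ^ 2 *
      ((∏ i ∈ IkSet k n, β i) / ∏ j ∈ J, β j) := by
  rw [alphaJ_eq]
  generalize IkSet k n = I
  have hb : ∀ s : Finset (Fin n), ∏ i ∈ s, β i ≠ 0 :=
    fun s => Finset.prod_ne_zero_iff.2 fun _ _ => hβ _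
  have hs := SS_ne κ hκ
  rw [← Finset.prod_inter_mul_prod_sdiff I J β, ← Finset.prod_inter_mul_prod_sdiff J I β]
  rw [SS_inter_left κ I J I, SS_inter_right κ I J (I ∩ J), SS_inter_right κ I J (I \ J),
    SS_inter_left κ J I J, SS_inter_right κ J I (J ∩ I), SS_inter_right κ J I (J \ I),
    SS_inter_left κ J I I, SS_inter_right κ I J (J ∩ I), SS_inter_right κ I J (J \ I),
    Finset.inter_comm J I, SS_symm κ (J \ I) (I \ J), SS_symm κ (J \ I) (I ∩ J),
    SS_symm κ (I \ J) (I ∩ J)]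
  have h1 := hs (I ∩ J) (I ∩ J)
  have h2 := hs (I ∩ J) (I \ J)
  have h3 := hs (I ∩ J) (J \ I)
  have h4 := hs (I \ J) (J \ I)
  have h5 := hb (I ∩ J)
  have h6 := hb (J \ I)
  field_simp

lemma vandK_map {k n : ℕ} (κ : Fin n → ℂ) (e : Fin k ↪o Fin n) :
    vandK κ (Finset.univ.map e.toEmbedding) = (Matrix.vandermonde (κ ∘ e)).det := by
  rw [Matrix.det_vandermonde, vandK, Finset.prod_filter, Finset.prod_product, Finset.prod_map]
  refine Finset.prod_congr rfl fun i _ => ?_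
  rw [Finset.prod_map]
  have : Finset.Ioi i = Finset.univ.filter (fun j => i < j) := by ext; simp
  rw [this, Finset.prod_filter]
  simp

lemma IkSet_eq {k n : ℕ} (h : k ≤ n) :
    IkSet k n = Finset.univ.map (Fin.castLEOrderEmb h).toEmbedding := by
  ext j
  simp only [IkSet, Finset.mem_filter, Finset.mem_univ, true_and, Finset.mem_map]
  constructor
  · intro hj
    exact ⟨⟨j, hj⟩, rfl⟩
  · rintro ⟨a, rfl⟩
    exact a.2

noncomputable def ww {n : ℕ} (k : ℕ) (κ β : Fin n → ℂ) (j : Fin n) : ℂ :=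
  β j * (∏ l ∈ IkSet k n, hh κ j l) ^ 2

lemma ww_eq {n : ℕ} (k : ℕ) (κ β : Fin n → ℂ) (j : Fin n) :
    ww k κ β j = β j * (∏ l ∈ (IkSet k n).erase j, (κ j - κ l)) ^ 2 := by
  unfold ww
  congr 1
  have : ∏ l ∈ IkSet k n, hh κ j l = ∏ l ∈ (IkSet k n).erase j, hh κ j l := by
    symm
    apply Finset.prod_erase
    simp [hh]
  rw [this, ← Finset.prod_pow, ← Finset.prod_pow]
  refine Finset.prod_congr rfl fun l hl => hh_sq κ _ _ (Finset.ne_of_mem_erase hl).symm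

lemma ww_ne {n : ℕ} (k : ℕ) (κ β : Fin n → ℂ) (hκ : Function.Injective κ)
    (hβ : ∀ j, β j ≠ 0) (j : Fin n) : ww k κ β j ≠ 0 :=
  mul_ne_zero (hβ j) (pow_ne_zero _ (Finset.prod_ne_zero_iff.2 fun _ _ => hh_ne κ hκ _ _))

lemma prod_ww {n : ℕ} (k : ℕ) (κ β : Fin n → ℂ) (J : Finset (Fin n)) :
    ∏ j ∈ J, ww k κ β j = (∏ j ∈ J, β j) * SS κ J (IkSet k n) ^ 2 := by
  unfold ww SS
  rw [Finset.prod_mul_distrib, Finset.prod_pow]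

lemma mem_Ik {k n : ℕ} (j : Fin n) : j ∈ IkSet k n ↔ (j : ℕ) < k := by simp [IkSet]

lemma A_entry (g k : ℕ) (hkg : k ≤ g)
    (κ β : Fin (g + 1) → ℂ) (hκ : Function.Injective κ) (hβ : ∀ j, β j ≠ 0)
    (i : Fin k) (j : Fin (g + 1)) :
    bananaA g k hkg κ β i j = ww k κ β (Fin.castLE (Nat.le_succ_of_le hkg) i) *
      (((Lagrange.basis (IkSet k (g+1)) κ (Fin.castLE (Nat.le_succ_of_le hkg) i)).eval (κ j)) *
       (ww k κ β j)⁻¹) := by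
  have hw := ww_ne k κ β hκ hβ
  set c := Fin.castLE (Nat.le_succ_of_le hkg) i with hc
  have hcI : c ∈ IkSet k (g+1) := by rw [mem_Ik]; simp [hc]
  simp only [bananaA, Matrix.of_apply]
  rw [← hc]
  split_ifs with h1 h2
  · have : c = j := by ext; simpa [hc] using h2
    rw [← this, Lagrange.eval_basis_self hκ.injOn hcI]
    field_simp [hw c]
  · have : c ≠ j := by
      intro h; apply h2; rw [← h]; simp [hc]
    rw [Lagrange.eval_basis_of_ne this ((mem_Ik j).2 h1)]
    simp
  · have hj : j ∉ IkSet k (g+1) := by rwa [mem_Ik]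
    have hcj : κ j - κ c ≠ 0 := sub_ne_zero.2 fun e => hj (by rw [hκ e]; exact hcI)
    rw [ww_eq, ww_eq, Finset.erase_eq_of_notMem hj, ← Finset.mul_prod_erase _ _ hcI,
      Lagrange.basis, Polynomial.eval_prod]
    simp only [Lagrange.basisDivisor, Polynomial.eval_mul, Polynomial.eval_C, Polynomial.eval_sub,
      Polynomial.eval_X]
    rw [Finset.prod_mul_distrib, Finset.prod_inv_distrib, Finset.prod_div_distrib]
    have n1 : ∏ l ∈ (IkSet k (g+1)).erase c, (κ c - κ l) ≠ 0 :=
      Finset.prod_ne_zero_iff.2 fun l hl =>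
        sub_ne_zero.2 fun e => Finset.ne_of_mem_erase hl (hκ e).symm
    have n2 : ∏ l ∈ (IkSet k (g+1)).erase c, (κ j - κ l) ≠ 0 :=
      Finset.prod_ne_zero_iff.2 fun l hl =>
        sub_ne_zero.2 fun e => hj (by rw [hκ e]; exact Finset.mem_of_mem_erase hl)
    have := hβ j
    field_simp

lemma minor_eq (g k : ℕ) (hkg : k ≤ g)
    (κ β : Fin (g + 1) → ℂ) (hκ : Function.Injective κ) (hβ : ∀ j, β j ≠ 0)
    (J : Finset (Fin (g + 1))) (hJ : J.card = k) :
    maximalMinor (bananaA g k hkg κ β) J hJ * vandK κ (IkSet k (g+1)) =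
      (∏ i ∈ IkSet k (g+1), ww k κ β i) / (∏ j ∈ J, ww k κ β j) * vandK κ J := by
  have hle : k ≤ g + 1 := Nat.le_succ_of_le hkg
  let L : Matrix (Fin k) (Fin k) ℂ := Matrix.of fun i i' =>
    (Lagrange.basis (IkSet k (g+1)) κ (Fin.castLE hle i)).eval (κ (J.orderEmbOfFin hJ i'))
  have hI : (IkSet k (g+1)) = Finset.univ.map (Fin.castLEOrderEmb hle).toEmbedding := IkSet_eq hle
  have hJ' : Finset.univ.map (J.orderEmbOfFin hJ).toEmbedding = J :=
    Finset.map_orderEmbOfFin_univ J hJ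
  have hIc : (IkSet k (g+1)).card = k := by rw [hI]; simp
  have h1 : maximalMinor (bananaA g k hkg κ β) J hJ =
      (∏ i ∈ IkSet k (g+1), ww k κ β i) * (L.det * (∏ j ∈ J, ww k κ β j)⁻¹) := by
    have : (Matrix.of fun i i' : Fin k => bananaA g k hkg κ β i (J.orderIsoOfFin hJ i').val) =
        Matrix.diagonal (fun i => ww k κ β (Fin.castLE hle i)) *
        (L * Matrix.diagonal (fun i => (ww k κ β (J.orderEmbOfFin hJ i))⁻¹)) := by
      ext i i'
      rw [Matrix.diagonal_mul, Matrix.mul_diagonal, Matrix.of_apply, A_entry g k hkg κ β hκ hβ]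
      rfl
    rw [maximalMinor, this, Matrix.det_mul, Matrix.det_mul, Matrix.det_diagonal,
      Matrix.det_diagonal]
    congr 1
    · rw [hI, Finset.prod_map]; rfl
    · congr 1
      conv_rhs => rw [← hJ', Finset.prod_map]
      rw [Finset.prod_inv_distrib]; rfl
  have h2 : vandK κ (IkSet k (g+1)) * L.det = vandK κ J := by
    conv_rhs => rw [← hJ']
    conv_lhs => rw [hI]
    rw [vandK_map, vandK_map, ← Matrix.det_transpose, ← Matrix.det_mul,
      ← Matrix.det_transpose (Matrix.vandermonde _)]
    congr 1
    ext m i'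
    simp only [Matrix.mul_apply, Matrix.transpose_apply, Matrix.vandermonde_apply, L,
      Matrix.of_apply, Function.comp]
    have := Lagrange.eq_interpolate (s := IkSet k (g+1)) (v := κ) (f := (Polynomial.X ^ (m:ℕ) : Polynomial ℂ))
      hκ.injOn (by rw [hIc, Polynomial.degree_X_pow]; exact_mod_cast m.2)
    have h3 := congrArg (Polynomial.eval (κ (J.orderEmbOfFin hJ i'))) this
    rw [Lagrange.interpolate_apply, Polynomial.eval_finsetSum] at h3
    simp only [Polynomial.eval_mul, Polynomial.eval_C, Polynomial.eval_pow, Polynomial.eval_X] at h3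
    rw [h3]
    conv_rhs => rw [hI, Finset.sum_map]
    rw [← hI]
    rfl
  rw [h1, ← h2]
  ring

lemma coef_eq (g k : ℕ) (hkg : k ≤ g)
    (κ β : Fin (g + 1) → ℂ) (hκ : Function.Injective κ) (hβ : ∀ j, β j ≠ 0)
    (J : Finset (Fin (g + 1))) (hJ : J.card = k) :
    maximalMinor (bananaA g k hkg κ β) J hJ * vandK κ J =
      vandK κ (IkSet k (g+1)) * alphaJ k κ β J := by
  have h := minor_eq g k hkg κ β hκ hβ J hJ
  rw [prod_ww, prod_ww] at h
  rw [alphaJ_eq2 k κ β hκ hβ]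
  have h1 := vandK_sq κ (IkSet k (g+1))
  have h2 := vandK_sq κ J
  have n1 := vandK_ne κ hκ (IkSet k (g+1))
  have n2 := SS_ne κ hκ J (IkSet k (g+1))
  have hb : ∏ i ∈ J, β i ≠ 0 := Finset.prod_ne_zero_iff.2 fun _ _ => hβ _
  rw [← h1] at h ⊢
  rw [← h2]
  rw [← eq_div_iff n1] at h
  rw [h]
  field_simp

lemma exp_eq (g k : ℕ) (e : Fin (g + 1) → ℂ) (I J : Finset (Fin (g + 1)))
    (hI : I.card = k) (hJ : J.card = k) :
    (∑ l : Fin g, (((if l.succ ∈ I then (1 : ℤ) else 0) -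
                (if l.succ ∈ J then (1 : ℤ) else 0) : ℤ) : ℂ) * (e 0 - e l.succ))
      + ∑ i ∈ I, e i = ∑ j ∈ J, e j := by
  have h := Fin.sum_univ_succ (fun l => (((if l ∈ I then (1 : ℤ) else 0) -
                (if l ∈ J then (1 : ℤ) else 0) : ℤ) : ℂ) * (e 0 - e l))
  simp only [sub_self, mul_zero, zero_add] at h
  rw [← h]
  push_cast
  simp only [sub_mul, ite_mul, one_mul, zero_mul, Finset.sum_sub_distrib]
  simp [Finset.sum_ite_mem, hI, hJ]

/-- The tropical tau function of the banana graph equals the Grassmannian multi-soliton tau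
function `τ_A` divided by `K_{I_k} E_{I_k}`: for all `(x,y,t) ∈ ℂ³`,
`Σ_J α_J exp(Σ_l (c_J)_l (U_l x + V_l y + W_l t))
  = (1/(K_{I_k} ∏_{i∈I_k} E_i)) Σ_J A_J K_J ∏_{j∈J} E_j`,
sums over all `k`-element subsets `J` of `{1,…,n}`, where `(c_J)_l = [l+1 ∈ I_k] − [l+1 ∈ J]`,
`U_l = κ₁ − κ_{l+1}`, `V_l = κ₁² − κ_{l+1}²`, `W_l = κ₁³ − κ_{l+1}³` and
`E_j(x,y,t) = exp(κ_j x + κ_j² y + κ_j³ t)`. -/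
theorem stmt15 (g k : ℕ) (hg : 1 ≤ g) (hk1 : 1 ≤ k) (hkg : k ≤ g)
    (κ β : Fin (g + 1) → ℂ) (hκ : Function.Injective κ)
    (hβ0 : β 0 = 1) (hβ : ∀ j : Fin (g + 1), j ≠ 0 → β j ≠ 0)
    (x y t : ℂ) :
    ∑ J ∈ (Finset.powersetCard k (Finset.univ : Finset (Fin (g + 1)))).attach,
        alphaJ k κ β J.1 *
          Complex.exp (∑ l : Fin g,
            (((if l.succ ∈ IkSet k (g + 1) then (1 : ℤ) else 0) -
                (if l.succ ∈ J.1 then (1 : ℤ) else 0) : ℤ) : ℂ) *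
              ((κ 0 - κ l.succ) * x + (κ 0 ^ 2 - κ l.succ ^ 2) * y +
                (κ 0 ^ 3 - κ l.succ ^ 3) * t)) =
      (1 / (vandK κ (IkSet k (g + 1)) *
          ∏ i ∈ IkSet k (g + 1), Complex.exp (κ i * x + κ i ^ 2 * y + κ i ^ 3 * t))) *
        ∑ J ∈ (Finset.powersetCard k (Finset.univ : Finset (Fin (g + 1)))).attach,
          maximalMinor (bananaA g k hkg κ β) J.1 (Finset.mem_powersetCard.mp J.2).2 *
            vandK κ J.1 *
            ∏ j ∈ J.1, Complex.exp (κ j * x + κ j ^ 2 * y + κ j ^ 3 * t) := by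
  have hβ' : ∀ j, β j ≠ 0 := by
    intro j
    by_cases h : j = 0
    · rw [h, hβ0]; exact one_ne_zero
    · exact hβ j h
  have n1 := vandK_ne κ hκ (IkSet k (g+1))
  have hIc : (IkSet k (g+1)).card = k := by rw [IkSet_eq (Nat.le_succ_of_le hkg)]; simp
  rw [Finset.mul_sum]
  refine Finset.sum_congr rfl fun J _ => ?_
  have hJ := (Finset.mem_powersetCard.mp J.2).2
  rw [coef_eq g k hkg κ β hκ hβ' J.1 hJ]
  have he := exp_eq g k (fun j => κ j * x + κ j ^ 2 * y + κ j ^ 3 * t) (IkSet k (g+1)) J.1 hIc hJ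
  rw [← Complex.exp_sum, ← Complex.exp_sum, ← he, Complex.exp_add]
  have n2 := Complex.exp_ne_zero (∑ i ∈ IkSet k (g+1), (κ i * x + κ i ^ 2 * y + κ i ^ 3 * t))
  have hs : ∀ l : Fin g, (κ 0 - κ l.succ) * x + (κ 0 ^ 2 - κ l.succ ^ 2) * y +
                (κ 0 ^ 3 - κ l.succ ^ 3) * t = (κ 0 * x + κ 0 ^ 2 * y + κ 0 ^ 3 * t) -
       (κ l.succ * x + κ l.succ ^ 2 * y + κ l.succ ^ 3 * t) := fun l => by ring
  simp only [hs]
  generalize Complex.exp (∑ i ∈ IkSet k (g+1), (κ i * x + κ i ^ 2 * y + κ i ^ 3 * t)) = E at *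
  field_simp
end
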